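/- Let a_2 > a_1 > a_0 ≥ 2 and let P(z) = z^{a_1+a_2}Q(z) + z^{a_1+1}R(z) + S(z) with Q(z) = z^{a_0+1} - 2z^{a_0} + 1, R(z) = z^{a_2-a_1+a_0-1} - z^{a_2-a_1} + z^{a_0-1} - 1, S(z) = -z^{a_0+1} + 2z - 1. Suppose ζ is a root of unity with P(ζ) = 0, and suppose there exist integers η_1 ∈ {0, a_0, a_0+1}, η_2 ∈ {1, a_0}, η_3 ∈ {0, 1, a_0+1} and nonzero integers c_1, c_2, c_3 with c_1·ζ^{a_1+a_2+η_1} + c_2·ζ^{a_1+η_2} + c_3·ζ^{η_3} = 0. Then the order of ζ divides 6·gcd(a_1+a_2+η_1-η_3, a_1+η_2-η_3), and in particular ord(ζ) ≤ 6(2a_0 + a_2 - a_1). -/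

import Mathlib

lemma aux_int (x : ℂ) (n : ℕ) (hn : 0 < n) (hx : x ^ n = 1) (a b : ℤ) (hb : b ≠ 0)
    (h : (b : ℂ) * (x + x⁻¹) = a) : ∃ m : ℤ, x + x⁻¹ = m ∧ -2 ≤ m ∧ m ≤ 2 := by
  have hi : IsIntegral ℤ x := IsIntegral.of_pow hn (by rw [hx]; exact isIntegral_one)
  have hx' : x⁻¹ ^ n = 1 := by rw [inv_pow, hx, inv_one]
  have hi' : IsIntegral ℤ x⁻¹ := IsIntegral.of_pow hn (by rw [hx']; exact isIntegral_one)
  have hs := hi.add hi'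
  have hb' : (b : ℂ) ≠ 0 := by exact_mod_cast hb
  have hq : x + x⁻¹ = algebraMap ℚ ℂ ((a : ℚ) / b) := by
    simp only [eq_ratCast]; push_cast; field_simp; rw [← h]; field_simp
  rw [hq] at hs
  have hs2 : IsIntegral ℤ ((a : ℚ) / b) :=
    (isIntegral_algebraMap_iff (algebraMap ℚ ℂ).injective).1 hs
  obtain ⟨m, hm⟩ := IsIntegrallyClosed.isIntegral_iff.1 hs2
  have hm2 : x + x⁻¹ = m := by rw [hq, ← hm]; simp
  refine ⟨m, hm2, ?_⟩
  have h1 : ‖x‖ = 1 := Complex.norm_eq_one_of_pow_eq_one hx hn.ne'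
  have h2 : ‖(m : ℂ)‖ ≤ 2 := by
    rw [← hm2]; refine (norm_add_le _ _).trans ?_
    rw [norm_inv, h1]; norm_num
  rw [Complex.norm_intCast] at h2
  have := abs_le.1 h2
  exact ⟨by exact_mod_cast this.1, by exact_mod_cast this.2⟩

lemma aux_six (x y : ℂ) (n : ℕ) (hn : 0 < n) (hx : x ^ n = 1) (hy : y ^ n = 1)
    (c1 c2 c3 : ℤ) (hc1 : c1 ≠ 0) (hc2 : c2 ≠ 0) (hc3 : c3 ≠ 0)
    (h : c1 * x + c2 * y + c3 = 0) : x ^ 6 = 1 := by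
  have hx0 : x ≠ 0 := by rintro rfl; simp [hn.ne'] at hx
  have hy0 : y ≠ 0 := by rintro rfl; simp [hn.ne'] at hy
  have cx : (starRingEnd ℂ) x = x⁻¹ := by
    rw [Complex.inv_eq_conj (Complex.norm_eq_one_of_pow_eq_one hx hn.ne')]
  have cy : (starRingEnd ℂ) y = y⁻¹ := by
    rw [Complex.inv_eq_conj (Complex.norm_eq_one_of_pow_eq_one hy hn.ne')]
  have h' : c1 * x⁻¹ + c2 * y⁻¹ + c3 = 0 := by
    have := congrArg (starRingEnd ℂ) h
    simpa [cx, cy] using this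
  have ex : x * x⁻¹ = 1 := mul_inv_cancel₀ hx0
  have ey : y * y⁻¹ = 1 := mul_inv_cancel₀ hy0
  obtain ⟨m, hm, m1, m2⟩ := aux_int x n hn hx (c2^2 - c1^2 - c3^2) (c1*c3) (mul_ne_zero hc1 hc3)
    (by
      push_cast
      linear_combination (c1 * x⁻¹ + c3) * h - c2 * y * h' - c1^2 * ex + c2^2 * ey)
  obtain ⟨k, hk, k1, k2⟩ := aux_int y n hn hy (c1^2 - c2^2 - c3^2) (c2*c3) (mul_ne_zero hc2 hc3)
    (by
      push_cast
      linear_combination (c2 * y⁻¹ + c3) * h - c1 * x * h' - c2^2 * ey + c1^2 * ex)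
  have hq : x ^ 2 - m * x + 1 = 0 := by
    rw [← hm]; linear_combination -ex
  have key : m ≠ 0 := by
    rintro rfl
    have e1 : ((c2 * k + 2 * c3 : ℤ) : ℂ) = 0 := by
      push_cast; rw [← hk]; push_cast at hm; linear_combination h + h' - c1 * hm
    have e2 : (( c2^2 - c1^2 - c3^2 : ℤ) : ℂ) = 0 := by
      push_cast; push_cast at hm
      linear_combination -((c1 * x⁻¹ + c3) * h - c2 * y * h' - c1^2 * ex + c2^2 * ey) + c1 * c3 * hm
    have f1 : c2 * k + 2 * c3 = 0 := by exact_mod_cast e1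
    have f2 : c2^2 - c1^2 - c3^2 = 0 := by exact_mod_cast e2
    have f3 : 4 * c1^2 = c2^2 * (4 - k^2) := by
      linear_combination (-4) * f2 - (2*c3 - c2 * k) * f1
    have irr : ∀ a b : ℤ, b ≠ 0 → a ^ 2 ≠ 3 * b ^ 2 := by
      intro a b hb hab
      have := Nat.Prime.irrational_sqrt Nat.prime_three
      apply this
      have hb' : (b : ℝ) ≠ 0 := by exact_mod_cast hb
      refine ⟨|(a : ℚ) / b|, ?_⟩
      push_cast
      rw [← Real.sqrt_sq_eq_abs]
      congr 1
      have : (a : ℝ)^2 = 3 * b^2 := by exact_mod_cast hab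
      field_simp; linarith
    interval_cases k
    · exact hc1 (by nlinarith)
    · exact irr (2*c1) c2 hc2 (by linarith)
    · omega
    · exact irr (2*c1) c2 hc2 (by linarith)
    · exact hc1 (by nlinarith)
  have : m = -2 ∨ m = -1 ∨ m = 1 ∨ m = 2 := by omega
  rcases this with rfl | rfl | rfl | rfl <;> push_cast at hq
  · have : x = -1 := by
      have : (x+1)^2 = 0 := by linear_combination hq
      linear_combination pow_eq_zero_iff (two_ne_zero) |>.1 this
    rw [this]; norm_num
  · linear_combination (x^4 - x^3 + x - 1) * hq
  · linear_combination (x^4 + x^3 - x - 1) * hq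
  · have : x = 1 := by
      have : (x-1)^2 = 0 := by linear_combination hq
      linear_combination pow_eq_zero_iff (two_ne_zero) |>.1 this
    rw [this]; norm_num

lemma aux_real (a φ x y : ℝ) (ha : 2 ≤ a) (hφ : 0 < φ) (hs : a * φ < Real.pi / 6)
    (hx : (a + 2) * φ ≤ x) (hx' : x < Real.pi) (hy : (a + 2) * φ ≤ y) (hy' : y < Real.pi)
    (h : Real.sin ((a - 1) * φ) * Real.sin x * Real.sin y
      = Real.sin φ * Real.sin (a * φ) * Real.sin (x + y)) : False := by
  have hpi := Real.pi_pos
  have hc : ∀ x, (a + 2) * φ ≤ x → x < Real.pi →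
      0 < Real.sin x ∧ (a+2) * φ * Real.cos x < Real.sin x := by
    intro x hx hx'
    have h0 : 0 < (a+2)*φ := by positivity
    have hx0 : 0 < x := by linarith
    have hsx := Real.sin_pos_of_pos_of_lt_pi hx0 hx'
    refine ⟨hsx, ?_⟩
    rcases le_or_gt (Real.cos x) 0 with hcx | hcx
    · nlinarith
    · have : x < Real.pi / 2 := by
        by_contra hh
        have := Real.cos_nonpos_of_pi_div_two_le_of_le (not_lt.1 hh) (by linarith)
        linarith
      have ht := Real.lt_tan hx0 this
      rw [Real.tan_eq_sin_div_cos, lt_div_iff₀ hcx] at ht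
      nlinarith
  obtain ⟨sx, cx⟩ := hc x hx hx'
  obtain ⟨sy, cy⟩ := hc y hy hy'
  have hφa : φ ≤ (a-1)*φ := by nlinarith
  have s1 : 0 < Real.sin φ := Real.sin_pos_of_pos_of_lt_pi hφ (by nlinarith)
  have s2 : Real.sin φ ≤ Real.sin ((a-1)*φ) :=
    Real.sin_le_sin_of_le_of_le_pi_div_two (by linarith) (by nlinarith) hφa
  have s3 : 0 < Real.sin (a*φ) := Real.sin_pos_of_pos_of_lt_pi (by positivity) (by nlinarith)
  have s4 : Real.sin (a*φ) ≤ 2 * Real.sin ((a-1)*φ) := by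
    have : a * φ = (a-1)*φ + φ := by ring
    rw [this, Real.sin_add]
    nlinarith [Real.cos_le_one φ, Real.cos_le_one ((a-1)*φ)]
  have s5 : Real.sin φ < φ := Real.sin_lt hφ
  have k1 : (a+2)*φ * Real.sin (x+y) < 2 * (Real.sin x * Real.sin y) := by
    rw [Real.sin_add]; nlinarith
  have k2 : 2 * (Real.sin φ * Real.sin (a*φ)) ≤ (a+2)*φ * Real.sin ((a-1)*φ) := by
    have : Real.sin φ * Real.sin (a*φ) ≤ φ * (2 * Real.sin ((a-1)*φ)) :=
      mul_le_mul s5.le s4 s3.le hφ.le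
    have : 0 < φ * Real.sin ((a-1)*φ) := mul_pos hφ (by linarith)
    nlinarith
  have k3 := mul_lt_mul_of_pos_left k1 (mul_pos s1 s3)
  have k4 := mul_le_mul_of_nonneg_right k2 (mul_pos sx sy).le
  nlinarith

open Complex in
lemma aux_exp (φ : ℝ) (a0 a1 a2 : ℕ)
    (h : (exp (2*φ*I) - 1) * (exp (2*φ*I) ^ a0 - 1) * (exp (2*φ*I) ^ (a1+a2) - 1)
      = (exp (2*φ*I) ^ a0 - exp (2*φ*I)) * (exp (2*φ*I)^a1 - 1) * (exp (2*φ*I)^a2 - 1)) :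
    Real.sin (((a0:ℝ) - 1) * φ) * Real.sin (a1 * φ) * Real.sin (a2 * φ)
      = Real.sin φ * Real.sin (a0 * φ) * Real.sin (a1 * φ + a2 * φ) := by
  have key : ∀ t : ℝ, exp (2*t*I) - 1 = 2 * I * exp (t * I) * (Real.sin t : ℂ) := by
    intro t
    have e1 : exp (2*t*I) = exp (t*I) * exp (t*I) := by rw [← exp_add]; congr 1; ring
    have e2 : exp (t*I) * exp (-t*I) = 1 := by rw [← exp_add]; simp
    rw [e1, ofReal_sin, Complex.sin]
    linear_combination e2 - (exp (t*I) * exp (-t*I) - exp (t*I)*exp (t*I)) * I_sq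
  have hp : ∀ k : ℕ, exp (2*φ*I) ^ k = exp (2 * ((k * φ : ℝ) : ℂ) * I) := by
    intro k; rw [← exp_nat_mul]; congr 1; push_cast; ring
  have hd : exp (2*φ*I)^a0 - exp (2*φ*I)
      = exp (2*φ*I) * (exp (2 * ((((a0:ℝ) - 1) * φ : ℝ) : ℂ) * I) - 1) := by
    rw [hp, mul_sub, ← exp_add, mul_one]; congr 2; push_cast; ring
  rw [hd, hp, hp, hp, hp, key, key, key, key, key, key] at h
  have e1 : exp (φ*I) * exp ((a0*φ:ℝ)*I) * exp ((((a1+a2:ℕ):ℝ)*φ:ℝ)*I) ≠ 0 := by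
    simp [exp_ne_zero]
  have e2 : exp (2*φ*I) * exp ((((a0:ℝ)-1)*φ:ℝ)*I) * exp ((a1*φ:ℝ)*I) * exp ((a2*φ:ℝ)*I) =
     exp (φ*I) * exp ((a0*φ:ℝ)*I) * exp ((((a1+a2:ℕ):ℝ)*φ:ℝ)*I) := by
    simp only [← exp_add]; congr 1; push_cast; ring
  have e3 : ((a1+a2:ℕ):ℝ)*φ = a1*φ+a2*φ := by push_cast; ring
  have hI : (2*I)^3 ≠ 0 := by simp
  have := mul_left_cancel₀ (mul_ne_zero hI e1) (b := ((Real.sin (((a0:ℝ) - 1) * φ) * Real.sin (a1 * φ) * Real.sin (a2 * φ) : ℝ):ℂ)) (c := ((Real.sin φ * Real.sin (a0 * φ) * Real.sin (((a1+a2:ℕ):ℝ)*φ) : ℝ):ℂ)) (by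
    push_cast at h e2 ⊢
    rw [← sub_eq_zero] at h ⊢
    linear_combination -h - (2*I)^3 * (sin ((a0 - 1) * φ) * sin (a1 * φ) * sin (a2 * φ)) * e2)
  rw [← e3]
  exact_mod_cast this

open Polynomial in
lemma aux_conj (n : ℕ) (hn : 0 < n) (z w : ℂ) (hz : IsPrimitiveRoot z n) (hw : IsPrimitiveRoot w n)
    (p : ℤ[X]) (h : aeval z p = 0) : aeval w p = 0 := by
  have h1 : minpoly ℤ z ∣ p := minpoly.isIntegrallyClosed_dvd (hz.isIntegral hn) h
  rw [← cyclotomic_eq_minpoly hz hn, cyclotomic_eq_minpoly hw hn] at h1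
  obtain ⟨q, rfl⟩ := h1
  simp

set_option maxHeartbeats 2000000 in
lemma aux_main (a0 a1 a2 : ℕ) (h0 : 2 ≤ a0) (h12 : a1 < a2) (n : ℕ) (φ : ℝ) (hφ : n * φ = Real.pi)
    (η1 η2 η3 : ℕ) (hη1 : η1 = 0 ∨ η1 = a0 ∨ η1 = a0 + 1)
    (hη2 : η2 = 1 ∨ η2 = a0) (hη3 : η3 = 0 ∨ η3 = 1 ∨ η3 = a0 + 1)
    (hAB : (a1 : ℤ) + a2 + η1 - η3 = 2 * ((a1 : ℤ) + η2 - η3))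
    (hdvd : (n : ℤ) ∣ 6 * ((a1 : ℤ) + η2 - η3))
    (hn : 6 * (2 * a0 + a2 - a1) < n)
    (h : Real.sin (((a0:ℝ) - 1) * φ) * Real.sin (a1 * φ) * Real.sin (a2 * φ)
      = Real.sin φ * Real.sin (a0 * φ) * Real.sin (a1 * φ + a2 * φ)) : False := by
  have hpi := Real.pi_pos
  obtain ⟨m, hm⟩ := hdvd
  obtain ⟨q, j, hqj, hj0, hj6⟩ : ∃ q j : ℤ, m = 6 * q + j ∧ 0 ≤ j ∧ j < 6 :=
    ⟨m / 6, m % 6, by omega, by omega, by omega⟩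
  have hn1 : 6 * (2 * a0 + 1) < n := by omega
  have hnR : 6 * (2 * (a0:ℝ) + 1) < n := by exact_mod_cast hn1
  have h0R : (2:ℝ) ≤ a0 := by exact_mod_cast h0
  have hφ0 : 0 < φ := by
    by_contra hh
    have : (n:ℝ) * φ ≤ 0 := mul_nonpos_of_nonneg_of_nonpos (by positivity) (not_lt.1 hh)
    linarith
  have hsm : 6 * (2 * (a0:ℝ) + 1) * φ < Real.pi := by
    rw [← hφ]; exact mul_lt_mul_of_pos_right hnR hφ0
  obtain ⟨s, hs⟩ : ∃ s : ℤ, s = η3 - η2 := ⟨_, rfl⟩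
  obtain ⟨t, ht⟩ : ∃ t : ℤ, t = η2 - η1 := ⟨_, rfl⟩
  have hst : s < t := by omega
  have hs1 : -(a0:ℤ) ≤ s ∧ s ≤ a0 := by omega
  have ht1 : -(a0:ℤ) ≤ t ∧ t ≤ a0 := by omega
  have hs1R : -(a0:ℝ) ≤ s ∧ (s:ℝ) ≤ a0 := by exact_mod_cast hs1
  have ht1R : -(a0:ℝ) ≤ t ∧ (t:ℝ) ≤ a0 := by exact_mod_cast ht1
  have hmR : 6 * ((a1:ℝ) - s) = n * (6 * q + j) := by
    have : 6 * ((a1:ℤ) - s) = n * (6 * q + j) := by rw [← hqj, ← hm, hs]; ring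
    exact_mod_cast this
  have ha2 : (a2:ℝ) = a1 + t - s := by
    have : (a2:ℤ) = a1 + t - s := by omega
    exact_mod_cast this
  have hX : (a1:ℝ) * φ = (j * Real.pi / 6 + s * φ) + q * Real.pi := by
    rw [← hφ]; linear_combination φ / 6 * hmR
  have hY : (a2:ℝ) * φ = (j * Real.pi / 6 + t * φ) + q * Real.pi := by
    rw [ha2]; linear_combination hX
  set x := j * Real.pi / 6 + s * φ with hx
  set y := j * Real.pi / 6 + t * φ with hy
  have h' : Real.sin (((a0:ℝ) - 1) * φ) * Real.sin x * Real.sin y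
      = Real.sin φ * Real.sin (a0 * φ) * Real.sin (x + y) := by
    rw [hX, hY] at h
    have e : x + q * Real.pi + (y + q * Real.pi) = x + y + q * (2 * Real.pi) := by ring
    rw [e, Real.sin_add_int_mul_two_pi, Real.sin_add_int_mul_pi, Real.sin_add_int_mul_pi] at h
    rw [← h]
    have : ((-1:ℝ)^q) * (-1)^q = 1 := by
      rw [← mul_zpow]; norm_num
    linear_combination (-(Real.sin (((a0:ℝ) - 1) * φ) * Real.sin x * Real.sin y)) * this
  clear_value x y
  have jφ : (s:ℝ) * φ ≤ a0 * φ ∧ -(a0 * φ) ≤ s * φ ∧ (t:ℝ) * φ ≤ a0 * φ ∧ -(a0 * φ) ≤ t * φ := by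
    refine ⟨?_, ?_, ?_, ?_⟩ <;> nlinarith
  have ha0φ : 2 * φ ≤ a0 * φ := by nlinarith
  by_cases hj : j = 0
  · subst hj
    have hx : x = s * φ := by rw [hx]; simp
    have hy : y = t * φ := by rw [hy]; simp
    have pos : ∀ k : ℤ, 0 < k → k ≤ 2 * a0 → 0 < Real.sin (k * φ) := by
      intro k hk hk'
      have hkR : (0:ℝ) < k := by exact_mod_cast hk
      have hkR' : (k:ℝ) ≤ 2 * a0 := by exact_mod_cast hk'
      apply Real.sin_pos_of_pos_of_lt_pi (by positivity)
      nlinarith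
    have neg : ∀ k : ℤ, k < 0 → -(2 * a0) ≤ k → Real.sin (k * φ) < 0 := by
      intro k hk hk'
      have := pos (-k) (by omega) (by omega)
      push_cast at this
      rw [neg_mul, Real.sin_neg] at this
      linarith
    have p1 := pos 1 (by omega) (by omega)
    have pa := pos a0 (by omega) (by omega)
    have pa1 := pos (a0 - 1) (by omega) (by omega)
    push_cast at p1 pa pa1
    rw [one_mul] at p1
    have hxy : x + y = ((s + t : ℤ) : ℝ) * φ := by rw [hx, hy]; push_cast; ring
    rw [hxy, hx, hy] at h'
    have pp := mul_pos p1 pa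
    rcases lt_trichotomy s 0 with s0 | s0 | s0
    · have ns := neg s s0 (by omega)
      rcases lt_trichotomy t 0 with t0 | t0 | t0
      · have nt := neg t t0 (by omega)
        have nst := neg (s+t) (by omega) (by omega)
        have := mul_neg_of_pos_of_neg pp nst
        have := mul_pos_of_neg_of_neg (mul_neg_of_pos_of_neg pa1 ns) nt
        linarith
      · subst t0
        simp only [add_zero] at h'
        have := mul_neg_of_pos_of_neg pp ns
        simp at h'
        rcases h' with (h' | h') | h' <;> linarith
      · have pt := pos t t0 (by omega)
        have : 0 ≤ Real.sin (((s+t:ℤ):ℝ)*φ) := by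
          rcases (show 0 ≤ s + t by omega).eq_or_lt with e | e
          · rw [← e]; simp
          · exact (pos _ e (by omega)).le
        have := mul_nonneg pp.le this
        have := mul_neg_of_neg_of_pos (mul_neg_of_pos_of_neg pa1 ns) pt
        linarith
    · subst s0
      have pt := pos t (by omega) (by omega)
      simp only [zero_add] at h'
      have := mul_pos pp pt
      simp at h'
      rcases h' with (h' | h') | h' <;> linarith
    · have hs1 : s = 1 := by omega
      have hta : t = a0 := by omega
      subst hs1 hta
      push_cast at h'
      rw [one_mul] at h'
      have : Real.sin (((a0:ℝ)-1)*φ) = Real.sin ((1 + a0)*φ) := by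
        apply mul_left_cancel₀ pp.ne'
        linarith
      have hlt : Real.sin (((a0:ℝ)-1)*φ) < Real.sin ((1 + a0)*φ) := by
        apply Real.sin_lt_sin_of_lt_of_le_pi_div_two <;> nlinarith
      linarith
  · have hj1 : 1 ≤ j := by omega
    have key : (a0 + 2) * φ ≤ j * Real.pi / 6 - a0 * φ := by
      rcases hj1.eq_or_lt with e | e
      · subst e
        have h6 : 6 ∣ n := by
          have h6' : (6:ℤ) ∣ n * (6 * q + 1) := ⟨_, by rw [hqj] at hm; exact hm.symm⟩
          have : IsCoprime (6:ℤ) (6 * q + 1) := ⟨-q, 1, by ring⟩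
          exact_mod_cast this.dvd_of_dvd_mul_right h6'
        have : 6 * (2 * a0 + 2) ≤ n := by omega
        have : 6 * (2 * (a0:ℝ) + 2) ≤ n := by exact_mod_cast this
        have := mul_le_mul_of_nonneg_right this hφ0.le
        rw [hφ] at this
        push_cast; linarith
      · have : (2:ℝ) ≤ j := by exact_mod_cast e
        have := mul_le_mul_of_nonneg_right this hpi.le
        linarith
    have hj5 : (j:ℝ) * Real.pi ≤ 5 * Real.pi := by
      have : (j:ℝ) ≤ 5 := by exact_mod_cast (show j ≤ 5 by omega)
      exact mul_le_mul_of_nonneg_right this hpi.le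
    exact aux_real a0 φ x y h0R hφ0 (by linarith) (by linarith) (by linarith) (by linarith)
      (by linarith) h'


theorem stmt_14 (a0 a1 a2 : ℕ) (h0 : 2 ≤ a0) (h01 : a0 < a1) (h12 : a1 < a2)
    (ζ : ℂ) (hζ : ∃ n : ℕ, 0 < n ∧ ζ ^ n = 1)
    (hP : ζ ^ (a1 + a2) * (ζ ^ (a0 + 1) - 2 * ζ ^ a0 + 1)
        + ζ ^ (a1 + 1) * (ζ ^ (a2 - a1 + a0 - 1) - ζ ^ (a2 - a1) + ζ ^ (a0 - 1) - 1)
        + (-ζ ^ (a0 + 1) + 2 * ζ - 1) = 0)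
    (η1 η2 η3 : ℕ) (hη1 : η1 ∈ ({0, a0, a0 + 1} : Set ℕ))
    (hη2 : η2 ∈ ({1, a0} : Set ℕ)) (hη3 : η3 ∈ ({0, 1, a0 + 1} : Set ℕ))
    (c1 c2 c3 : ℤ) (hc1 : c1 ≠ 0) (hc2 : c2 ≠ 0) (hc3 : c3 ≠ 0)
    (hrel : c1 * ζ ^ (a1 + a2 + η1) + c2 * ζ ^ (a1 + η2) + c3 * ζ ^ η3 = 0) :
    (orderOf ζ : ℤ) ∣
        6 * (Int.gcd ((a1 : ℤ) + a2 + η1 - η3) ((a1 : ℤ) + η2 - η3) : ℤ) ∧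
      orderOf ζ ≤ 6 * (2 * a0 + a2 - a1) := by
  have hn : 0 < orderOf ζ := by
    rw [orderOf_pos_iff, isOfFinOrder_iff_pow_eq_one]; exact hζ
  have hprim := IsPrimitiveRoot.orderOf ζ
  obtain ⟨n, hnn⟩ : ∃ n, n = orderOf ζ := ⟨_, rfl⟩
  rw [← hnn] at hn hprim ⊢
  have hz1 : ζ ^ n = 1 := hprim.pow_eq_one
  have hz0 : ζ ≠ 0 := by rintro rfl; simp [hn.ne'] at hz1
  simp only [Set.mem_insert_iff, Set.mem_singleton_iff] at hη1 hη2 hη3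
  have hzk : ∀ k : ℤ, (ζ ^ k) ^ n = 1 := by
    intro k; rw [← zpow_natCast, ← zpow_mul, mul_comm, zpow_mul, zpow_natCast, hz1, one_zpow]
  have e1 : ζ ^ (a1 + a2 + η1) = ζ ^ η3 * ζ ^ ((a1 : ℤ) + a2 + η1 - η3) := by
    rw [← zpow_natCast, ← zpow_natCast, ← zpow_add₀ hz0]; congr 1; push_cast; ring
  have e2 : ζ ^ (a1 + η2) = ζ ^ η3 * ζ ^ ((a1 : ℤ) + η2 - η3) := by
    rw [← zpow_natCast, ← zpow_natCast, ← zpow_add₀ hz0]; congr 1; push_cast; ring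
  have hr : (c1:ℂ) * ζ ^ ((a1 : ℤ) + a2 + η1 - η3) + c2 * ζ ^ ((a1 : ℤ) + η2 - η3) + c3 = 0 := by
    apply mul_left_cancel₀ (pow_ne_zero η3 hz0)
    rw [e1, e2] at hrel
    linear_combination hrel
  have dA : (n:ℤ) ∣ 6 * ((a1 : ℤ) + a2 + η1 - η3) := by
    rw [← hprim.zpow_eq_one_iff_dvd, mul_comm, zpow_mul]
    exact (zpow_natCast _ 6).trans <| aux_six _ _ n hn (hzk _) (hzk _) c1 c2 c3 hc1 hc2 hc3 hr
  have dB : (n:ℤ) ∣ 6 * ((a1 : ℤ) + η2 - η3) := by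
    rw [← hprim.zpow_eq_one_iff_dvd, mul_comm, zpow_mul]
    exact (zpow_natCast _ 6).trans <| aux_six _ (ζ ^ ((a1 : ℤ) + a2 + η1 - η3)) n hn (hzk _) (hzk _) c2 c1 c3 hc2 hc1 hc3
      (by linear_combination hr)
  have hG : (n : ℤ) ∣ 6 * (Int.gcd ((a1 : ℤ) + a2 + η1 - η3) ((a1 : ℤ) + η2 - η3) : ℤ) := by
    have := Int.dvd_coe_gcd dA dB
    rw [Int.gcd_mul_left] at this
    exact_mod_cast this
  refine ⟨hG, ?_⟩
  by_contra hlt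
  rw [not_le] at hlt
  by_cases hAB : (a1 : ℤ) + a2 + η1 - η3 = 2 * ((a1 : ℤ) + η2 - η3)
  · have hid : (ζ - 1) * (ζ ^ a0 - 1) * (ζ ^ (a1 + a2) - 1)
        - (ζ ^ a0 - ζ) * (ζ ^ a1 - 1) * (ζ ^ a2 - 1) = 0 := by
      obtain ⟨d, rfl⟩ := Nat.exists_eq_add_of_lt h12
      obtain ⟨b, rfl⟩ := Nat.exists_eq_add_of_le' h0
      have i1 : a1 + d + 1 - a1 + (b + 2) - 1 = d + b + 2 := by omega
      have i2 : a1 + d + 1 - a1 = d + 1 := by omega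
      have i3 : b + 2 - 1 = b + 1 := by omega
      rw [i1, i2, i3] at hP
      rw [← hP]; ring
    set w : ℂ := Complex.exp (2 * ((Real.pi / n : ℝ) : ℂ) * Complex.I) with hw
    have hwp : IsPrimitiveRoot w n := by
      have := Complex.isPrimitiveRoot_exp n hn.ne'
      convert this using 1
      rw [hw]; congr 1; push_cast; ring
    have hid' := aux_conj n hn ζ w hprim hwp
      ((Polynomial.X - 1) * (Polynomial.X ^ a0 - 1) * (Polynomial.X ^ (a1 + a2) - 1)
        - (Polynomial.X ^ a0 - Polynomial.X) * (Polynomial.X ^ a1 - 1) * (Polynomial.X ^ a2 - 1))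
      (by simpa using hid)
    simp only [map_sub, map_mul, map_pow, Polynomial.aeval_X, map_one] at hid'
    have hsin := aux_exp (Real.pi / n) a0 a1 a2 (sub_eq_zero.1 hid')
    have hnR : (n:ℝ) ≠ 0 := by exact_mod_cast hn.ne'
    exact aux_main a0 a1 a2 h0 h12 n (Real.pi / n) (by field_simp) η1 η2 η3 hη1 hη2 hη3 hAB dB
      hlt hsin
  · have hd : (n:ℤ) ∣ 6 * (((a1 : ℤ) + a2 + η1 - η3) - 2 * ((a1 : ℤ) + η2 - η3)) := by
      rw [mul_sub, mul_left_comm]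
      exact dvd_sub dA (dB.mul_left 2)
    have hle := Int.le_of_dvd (by
      rw [abs_pos]; omega) ((dvd_abs _ _).2 hd)
    rcases abs_cases (6 * (((a1 : ℤ) + a2 + η1 - η3) - 2 * ((a1 : ℤ) + η2 - η3))) with hh | hh <;>
      omega
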